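/- Let (X,μ,f) be uniquely ergodic, let p be a prime such that (X,μ,f^p) is not uniquely ergodic, and suppose (X,f^p) is topologically transitive. Then Q^e_{f^p}(X) ≠ X, i.e., there exists a point x ∈ X which is not a generic point of any f^p-ergodic measure. -/

import Mathlib

open MeasureTheory Filter Topology Set
open scoped ENNReal NNReal

attribute [local instance] Matrix.normedAddCommGroup

noncomputable section

/-- The cocycle `A(n,x) = A(f^{n-1}x) ⋯ A(fx) A(x)` generated by a matrix-valued map `A`. -/
def cocycle {X : Type*} {m : ℕ} (f : X → X) (A : X → Matrix (Fin m) (Fin m) ℝ) :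
    ℕ → X → Matrix (Fin m) (Fin m) ℝ
  | 0, _ => 1
  | n + 1, x => A (f^[n] x) * cocycle f A n x

/-- `A` is a uniform cocycle over `f` if `(1/n) log ‖A(n,x)‖` converges uniformly on `X`. -/
def IsUniformCocycle {X : Type*} [TopologicalSpace X] {m : ℕ} (f : X → X)
    (A : X → Matrix (Fin m) (Fin m) ℝ) : Prop :=
  ∃ L : X → ℝ, TendstoUniformly (fun (n : ℕ) (x : X) => Real.log ‖cocycle f A n x‖ / n) L atTop

/-- `A` is a continuous map from `X` to `GL(m,ℝ)`. -/
def ContGL {X : Type*} [TopologicalSpace X] {m : ℕ} (A : X → Matrix (Fin m) (Fin m) ℝ) : Prop :=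
  Continuous A ∧ ∀ x, IsUnit (A x)

/-- `μ` is an `f`-invariant Borel probability measure. -/
def InvProb {X : Type*} [MeasurableSpace X] (f : X → X) (μ : Measure X) : Prop :=
  IsProbabilityMeasure μ ∧ μ.map f = μ

/-- `f` is uniquely ergodic: it has exactly one invariant Borel probability measure. -/
def UniquelyErgodic {X : Type*} [MeasurableSpace X] (f : X → X) : Prop :=
  ∃! μ : Measure X, InvProb f μ

/-- `f` is uniquely ergodic with unique invariant Borel probability measure `μ`. -/
def UniquelyErgodicWith {X : Type*} [MeasurableSpace X] (f : X → X) (μ : Measure X) : Prop :=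
  InvProb f μ ∧ ∀ ν : Measure X, InvProb f ν → ν = μ

/-- `f` is totally uniquely ergodic: every positive power of `f` is uniquely ergodic. -/
def TotallyUniquelyErgodic {X : Type*} [MeasurableSpace X] (f : X → X) : Prop :=
  ∀ n : ℕ, 0 < n → UniquelyErgodic (f^[n])

/-- Topological transitivity. -/
def TopTransitive {X : Type*} [TopologicalSpace X] (f : X → X) : Prop :=
  ∀ U V : Set X, IsOpen U → IsOpen V → U.Nonempty → V.Nonempty →
    ∃ k : ℕ, 0 < k ∧ (f^[k] '' U ∩ V).Nonempty

/-- Total transitivity: every positive power is topologically transitive. -/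
def TotallyTransitive {X : Type*} [TopologicalSpace X] (f : X → X) : Prop :=
  ∀ n : ℕ, 0 < n → TopTransitive (f^[n])

/-- Topological weak mixing: `f × f` is topologically transitive. -/
def TopWeaklyMixing {X : Type*} [TopologicalSpace X] (f : X → X) : Prop :=
  TopTransitive (Prod.map f f)

/-- Topological mixing. -/
def TopMixing {X : Type*} [TopologicalSpace X] (f : X → X) : Prop :=
  ∀ U V : Set X, IsOpen U → IsOpen V → U.Nonempty → V.Nonempty →
    ∃ N : ℕ, 0 < N ∧ ∀ k ≥ N, (f^[k] '' U ∩ V).Nonempty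

/-- Minimality: every forward orbit is dense. -/
def MinimalSys {X : Type*} [TopologicalSpace X] (f : X → X) : Prop :=
  ∀ x : X, Dense (Set.range fun n : ℕ => f^[n] x)

/-- The `(n+1)`-th empirical measure `E_{f,n+1}(x) = (1/(n+1)) ∑_{i=0}^{n} δ_{f^i x}`,
as a Borel probability measure. -/
def empPM {X : Type*} [TopologicalSpace X] [MeasurableSpace X]
    (f : X → X) (x : X) (n : ℕ) : ProbabilityMeasure X :=
  ⟨((n + 1 : ℕ) : ℝ≥0∞)⁻¹ • ∑ i ∈ Finset.range (n + 1), Measure.dirac (f^[i] x), by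
    constructor
    simp [Measure.smul_apply, Measure.coe_finset_sum, Finset.sum_apply]
    rw [ENNReal.inv_mul_cancel] <;> simp⟩

/-- `V_f(x)`: the set of weak* accumulation points of the empirical measures of `x`. -/
def VSet {X : Type*} [TopologicalSpace X] [MeasurableSpace X] [OpensMeasurableSpace X]
    (f : X → X) (x : X) : Set (ProbabilityMeasure X) :=
  {ν | MapClusterPt ν atTop (empPM f x)}

/-- `G_{f,μ}`: the set of generic points of `μ` for `f`. -/
def genericPts {X : Type*} [TopologicalSpace X] [MeasurableSpace X] [OpensMeasurableSpace X]
    (f : X → X) (μ : ProbabilityMeasure X) : Set X :=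
  {x | VSet f x = {μ}}

/-- `Q_f^e(X)`: the union of the sets of generic points over all `f`-ergodic
Borel probability measures. -/
def QeSet {X : Type*} [TopologicalSpace X] [MeasurableSpace X] [OpensMeasurableSpace X]
    (f : X → X) : Set X :=
  ⋃ μ ∈ {μ : ProbabilityMeasure X | Ergodic f μ.toMeasure}, genericPts f μ

theorem isOpenMap_iterate {X : Type*} [TopologicalSpace X] {T : X → X} (hT : IsOpenMap T) :
    ∀ n : ℕ, IsOpenMap T^[n]
  | 0 => IsOpenMap.id
  | n + 1 => (isOpenMap_iterate hT n).comp hT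

/-- A pointwise limit of continuous functions that is invariant under a topologically transitive
open map is, up to `ε`, constant on a residual set. -/
theorem TopTransitive.exists_eventually_residual_abs_sub_le {X : Type*} [TopologicalSpace X]
    [BaireSpace X] [Nonempty X] {T : X → X} (hT : TopTransitive T) (hTo : IsOpenMap T)
    {g : ℕ → X → ℝ} (hg : ∀ n, Continuous (g n)) {L : X → ℝ}
    (hL : ∀ x, Tendsto (fun n => g n x) atTop (𝓝 (L x))) (hinv : ∀ x, L (T x) = L x)
    {ε : ℝ} (hε : 0 < ε) :
    ∃ c, ∀ᶠ x in residual X, |L x - c| ≤ ε := by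
  have hinv' : ∀ k x, L (T^[k] x) = L x := by
    intro k
    induction k with
    | zero => intro x; rfl
    | succ k ih => intro x; rw [Function.iterate_succ_apply, ih, hinv]
  let F : ℕ → Set X := fun N => ⋂ n ≥ N, {x | |g n x - g N x| ≤ ε / 2}
  have hFc : ∀ N, IsClosed (F N) := fun N =>
    isClosed_biInter fun n _ => isClosed_le ((hg n).sub (hg N)).abs continuous_const
  have hFU : ⋃ N, F N = Set.univ := by
    refine Set.eq_univ_of_forall fun x => Set.mem_iUnion.2 ?_
    obtain ⟨N, hN⟩ := Metric.cauchySeq_iff'.1 (hL x).cauchySeq (ε / 2) (half_pos hε)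
    refine ⟨N, Set.mem_iInter₂.2 fun n hn => ?_⟩
    have := hN n hn
    rw [Real.dist_eq] at this
    exact this.le
  obtain ⟨N, x₀, hx₀⟩ := nonempty_interior_of_iUnion_of_closed hFc hFU
  let U : Set X := interior (F N) ∩ {x | |g N x - g N x₀| < ε / 2}
  have hUo : IsOpen U := isOpen_interior.inter
    (isOpen_lt ((hg N).sub continuous_const).abs continuous_const)
  have hUne : U.Nonempty := ⟨x₀, hx₀, by simp [hε]⟩
  have hUL : ∀ x ∈ U, |L x - g N x₀| ≤ ε := by
    rintro x ⟨hx, hx'⟩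
    have h1 : |L x - g N x| ≤ ε / 2 := by
      refine le_of_tendsto ((hL x).sub_const (g N x)).abs ?_
      filter_upwards [eventually_ge_atTop N] with n hn
      exact Set.mem_iInter₂.1 (interior_subset hx) n hn
    have h2 : |g N x - g N x₀| < ε / 2 := hx'
    linarith [abs_sub_le (L x) (g N x) (g N x₀)]
  refine ⟨g N x₀, ?_⟩
  have hWo : IsOpen (⋃ k : ℕ, T^[k] '' U) := isOpen_iUnion fun k => isOpenMap_iterate hTo k U hUo
  have hWd : Dense (⋃ k : ℕ, T^[k] '' U) := by
    rw [dense_iff_inter_open]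
    intro V hV hVne
    obtain ⟨k, -, y, hyU, hyV⟩ := hT U V hUo hV hUne hVne
    exact ⟨y, hyV, Set.mem_iUnion.2 ⟨k, hyU⟩⟩
  filter_upwards [residual_of_dense_open hWo hWd] with y hy
  obtain ⟨k, x, hx, rfl⟩ := Set.mem_iUnion.1 hy
  rw [hinv']
  exact hUL x hx

/-- The empirical measures of a generic point of `ν` converge weakly to `ν`. -/
theorem tendsto_empPM_of_mem_genericPts {X : Type*} [MetricSpace X] [CompactSpace X]
    [MeasurableSpace X] [BorelSpace X] {T : X → X} {ν : ProbabilityMeasure X} {x : X}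
    (hx : x ∈ genericPts T ν) : Tendsto (empPM T x) atTop (𝓝 ν) := by
  refine tendsto_nhds_of_unique_mapClusterPt fun ν' hν' => ?_
  have h : ν' ∈ VSet T x := hν'
  rwa [show VSet T x = {ν} from hx] at h

theorem integral_empPM {X : Type*} [TopologicalSpace X] [MeasurableSpace X] [BorelSpace X]
    (T : X → X) (x : X) (n : ℕ) {φ : X → ℝ} (hφ : Continuous φ) :
    ∫ y, φ y ∂(empPM T x n : Measure X) = birkhoffAverage ℝ T φ (n + 1) x := by
  have hintegrable : ∀ i ∈ Finset.range (n + 1), Integrable φ (Measure.dirac (T^[i] x)) := by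
    intro i _
    exact integrable_dirac' hφ.stronglyMeasurable (by simp)
  change ∫ y, φ y ∂(((n + 1 : ℕ) : ℝ≥0∞)⁻¹ •
    ∑ i ∈ Finset.range (n + 1), Measure.dirac (T^[i] x)) = _
  rw [integral_smul_measure, integral_finsetSum_measure hintegrable, ENNReal.toReal_inv,
    ENNReal.toReal_natCast]
  simp only [integral_dirac' _ _ hφ.stronglyMeasurable]
  simp [birkhoffAverage, birkhoffSum]

/-- Birkhoff averages of a continuous function along the orbit of a generic point converge to
the space average. -/
theorem tendsto_birkhoffAverage_of_mem_genericPts {X : Type*} [MetricSpace X] [CompactSpace X]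
    [MeasurableSpace X] [BorelSpace X] {T : X → X} {ν : ProbabilityMeasure X} {x : X}
    (hx : x ∈ genericPts T ν) {φ : X → ℝ} (hφ : Continuous φ) :
    Tendsto (fun n => birkhoffAverage ℝ T φ n x) atTop (𝓝 (∫ y, φ y ∂(ν : Measure X))) := by
  rw [← tendsto_add_atTop_iff_nat 1]
  have h := ProbabilityMeasure.tendsto_iff_forall_integral_tendsto.1
    (tendsto_empPM_of_mem_genericPts hx) (BoundedContinuousFunction.mkOfCompact ⟨φ, hφ⟩)
  simpa [integral_empPM _ _ _ hφ] using h

/-- If `f` is uniquely ergodic, the average of an `f^p`-invariant probability measure over the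
first `p` iterates of `f` is the unique `f`-invariant probability measure. -/
theorem UniquelyErgodicWith.average_map_iterate {X : Type*} [MeasurableSpace X] {f : X → X}
    {μ : Measure X} (hue : UniquelyErgodicWith f μ) (hf : Measurable f) {p : ℕ} (hp : p ≠ 0)
    {ν : Measure X} (hν : InvProb (f^[p]) ν) :
    (p : ℝ≥0∞)⁻¹ • ∑ j ∈ Finset.range p, ν.map f^[j] = μ := by
  obtain ⟨hprob, hmap⟩ := hν
  refine hue.2 _ ⟨⟨?_⟩, ?_⟩
  · have h : ∀ j ∈ Finset.range p, ν.map f^[j] Set.univ = 1 := fun j _ => by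
      rw [Measure.map_apply (hf.iterate j) MeasurableSet.univ, Set.preimage_univ, measure_univ]
    rw [Measure.smul_apply, Measure.finsetSum_apply, Finset.sum_congr rfl h]
    simpa using ENNReal.inv_mul_cancel (by exact_mod_cast hp) (ENNReal.natCast_ne_top p)
  · rw [Measure.map_smul, ← Measure.mapₗ_apply_of_measurable hf, map_sum]
    congr 1
    simp only [Measure.mapₗ_apply_of_measurable hf, Measure.map_map hf (hf.iterate _),
      ← Function.iterate_succ']
    obtain ⟨q, rfl⟩ := Nat.exists_eq_succ_of_ne_zero hp
    rw [Finset.sum_range_succ, hmap, Finset.sum_range_succ' (fun j => ν.map f^[j])]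
    simp

/-- For a uniquely ergodic `f`, space averages of the translates of `φ` with respect to an
`f^p`-invariant measure sum up to `p` times the space average of `φ`. -/
theorem UniquelyErgodicWith.sum_integral_comp_iterate {X : Type*} [MetricSpace X] [CompactSpace X]
    [MeasurableSpace X] [BorelSpace X] {f : X → X}
    {μ : Measure X} (hue : UniquelyErgodicWith f μ) (hf : Continuous f) {p : ℕ} (hp : p ≠ 0)
    {ν : Measure X} (hν : InvProb (f^[p]) ν) {φ : X → ℝ} (hφ : Continuous φ) :
    ∑ j ∈ Finset.range p, ∫ y, φ (f^[j] y) ∂ν = p * ∫ y, φ y ∂μ := by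
  have := hν.1
  have hintegrable : ∀ j ∈ Finset.range p, Integrable φ (ν.map f^[j]) := fun j _ => by
    have := Measure.isProbabilityMeasure_map (μ := ν) (hf.iterate j).aemeasurable
    exact hφ.integrable_of_hasCompactSupport (HasCompactSupport.of_compactSpace φ)
  have hp' : (p : ℝ) ≠ 0 := by exact_mod_cast hp
  rw [← hue.average_map_iterate hf.measurable hp hν, integral_smul_measure,
    integral_finsetSum_measure hintegrable]
  simp only [integral_map (hf.iterate _).aemeasurable hφ.aestronglyMeasurable]
  simp [hp']

/-- Two Borel probability measures on a compact metric space that agree on a dense set of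
continuous functions are equal. -/
theorem ext_of_forall_integral_eq_of_dense {X : Type*} [MetricSpace X] [CompactSpace X]
    [MeasurableSpace X] [BorelSpace X] {ν μ : Measure X} [IsProbabilityMeasure ν]
    [IsProbabilityMeasure μ] {s : Set C(X, ℝ)} (hs : Dense s)
    (h : ∀ φ ∈ s, ∫ y, φ y ∂ν = ∫ y, φ y ∂μ) : ν = μ := by
  have hcont : ∀ (m : Measure X) [IsProbabilityMeasure m],
      Continuous fun φ : C(X, ℝ) => ∫ y, φ y ∂m := by
    intro m _
    have hintegrable : ∀ φ : C(X, ℝ), Integrable φ m := fun φ =>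
      φ.continuous.integrable_of_hasCompactSupport (HasCompactSupport.of_compactSpace φ)
    refine LipschitzWith.continuous (K := 1) (LipschitzWith.of_dist_le_mul fun φ ψ => ?_)
    rw [dist_eq_norm, ← integral_sub (hintegrable φ) (hintegrable ψ)]
    have := norm_integral_le_of_norm_le_const (μ := m) (f := fun y => φ y - ψ y) (C := dist φ ψ)
      (ae_of_all _ fun y => by rw [← dist_eq_norm]; exact ContinuousMap.dist_apply_le_dist y)
    simpa using this
  have heq := (hcont ν).ext_on hs (hcont μ) h
  refine ext_of_forall_integral_eq_of_IsFiniteMeasure fun φ => ?_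
  exact congrFun heq φ.toContinuousMap

/-- Lemma 3.1: if `(X,μ,f)` is uniquely ergodic, `f^p` is not uniquely ergodic for a prime
`p`, and `f^p` is topologically transitive, then some point of `X` is not a generic point
of any `f^p`-ergodic measure, i.e. `Q^e_{f^p}(X) ≠ X`. -/
theorem QeSet_ne_univ_of_not_uniquelyErgodic_pow
    {X : Type*} [MetricSpace X] [CompactSpace X] [MeasurableSpace X] [BorelSpace X]
    (f : X → X) (hf : IsHomeomorph f) (μ : Measure X) (hue : UniquelyErgodicWith f μ)
    (p : ℕ) (hp : p.Prime) (hnue : ¬ UniquelyErgodic (f^[p]))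
    (htrans : TopTransitive (f^[p])) :
    QeSet (f^[p]) ≠ Set.univ := by
  intro hQ
  have hp0 : p ≠ 0 := hp.ne_zero
  have hc := hf.continuous
  have hμ : IsProbabilityMeasure μ := hue.1.1
  have : Nonempty X := nonempty_of_isProbabilityMeasure μ
  have hgen : ∀ x, ∃ ν : ProbabilityMeasure X,
      Ergodic f^[p] (ν : Measure X) ∧ x ∈ genericPts f^[p] ν := by
    intro x
    have hx : x ∈ QeSet f^[p] := hQ ▸ Set.mem_univ x
    simpa [QeSet] using hx
  choose ν hν hxν using hgen
  have hinvν : ∀ x, InvProb f^[p] (ν x : Measure X) := fun x =>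
    ⟨inferInstance, (hν x).toMeasurePreserving.map_eq⟩
  have hlim : ∀ (φ : C(X, ℝ)) x, Tendsto (fun n => birkhoffAverage ℝ f^[p] φ n x) atTop
      (𝓝 (∫ y, φ y ∂(ν x : Measure X))) := fun φ x =>
    tendsto_birkhoffAverage_of_mem_genericPts (hxν x) φ.continuous
  have hshift : ∀ (φ : C(X, ℝ)) j x,
      ∫ y, φ y ∂(ν (f^[j] x) : Measure X) = ∫ y, φ (f^[j] y) ∂(ν x : Measure X) := by
    intro φ j x
    refine tendsto_nhds_unique (hlim φ (f^[j] x)) ?_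
    refine (hlim (φ.comp ⟨f^[j], hc.iterate j⟩) x).congr fun n => ?_
    simp only [birkhoffAverage, birkhoffSum, ContinuousMap.comp_apply, ContinuousMap.coe_mk,
      ← Function.iterate_mul, ← Function.iterate_add_apply, add_comm]
  have hinv : ∀ (φ : C(X, ℝ)) x,
      ∫ y, φ y ∂(ν (f^[p] x) : Measure X) = ∫ y, φ y ∂(ν x : Measure X) := by
    intro φ x
    rw [hshift, ← integral_map (φ := f^[p]) (hc.iterate p).aemeasurable
      φ.continuous.aestronglyMeasurable, (hinvν x).2]
  have hres : ∀ φ : C(X, ℝ), ∀ ε > 0, ∀ᶠ x in residual X,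
      |∫ y, φ y ∂(ν x : Measure X) - ∫ y, φ y ∂μ| ≤ ε := by
    intro φ ε hε
    obtain ⟨c, hcε⟩ := htrans.exists_eventually_residual_abs_sub_le (isOpenMap_iterate hf.isOpenMap p)
      (g := fun n => birkhoffAverage ℝ f^[p] φ n)
      (fun n => by
        have : ∀ i, Continuous ((f^[p])^[i]) := fun i => (hc.iterate p).iterate i
        unfold birkhoffAverage birkhoffSum
        fun_prop)
      (hlim φ) (hinv φ) (half_pos hε)
    have hall : ∀ᶠ x in residual X, ∀ j : ℕ,
        |∫ y, φ y ∂(ν (f^[j] x) : Measure X) - c| ≤ ε / 2 :=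
      eventually_countable_forall.2 fun j =>
        (tendsto_residual_of_isOpenMap (hc.iterate j) (isOpenMap_iterate hf.isOpenMap j)).eventually hcε
    filter_upwards [hall] with x hx
    have hsum : ∑ j ∈ Finset.range p, ∫ y, φ y ∂(ν (f^[j] x) : Measure X) = p * ∫ y, φ y ∂μ := by
      simp only [hshift]
      exact hue.sum_integral_comp_iterate hc hp0 (hinvν x) φ.continuous
    have hμc : |∫ y, φ y ∂μ - c| ≤ ε / 2 := by
      have hp' : (0 : ℝ) < p := by exact_mod_cast hp.pos
      have h : |p * (∫ y, φ y ∂μ - c)| ≤ p * (ε / 2) := by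
        calc |p * (∫ y, φ y ∂μ - c)|
            = |∑ j ∈ Finset.range p, (∫ y, φ y ∂(ν (f^[j] x) : Measure X) - c)| := by
              rw [Finset.sum_sub_distrib, hsum]; simp [mul_sub]
          _ ≤ ∑ j ∈ Finset.range p, |∫ y, φ y ∂(ν (f^[j] x) : Measure X) - c| :=
              Finset.abs_sum_le_sum_abs _ _
          _ ≤ ∑ _j ∈ Finset.range p, ε / 2 := Finset.sum_le_sum fun j _ => hx j
          _ = p * (ε / 2) := by simp
      rw [abs_mul, abs_of_pos hp'] at h
      exact le_of_mul_le_mul_left h hp'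
    have h0 : |∫ y, φ y ∂(ν x : Measure X) - c| ≤ ε / 2 := hx 0
    have := abs_sub_le (∫ y, φ y ∂(ν x : Measure X)) c (∫ y, φ y ∂μ)
    rw [abs_sub_comm c] at this
    linarith
  have hres' : ∀ᶠ x in residual X, ∀ k n : ℕ,
      |∫ y, TopologicalSpace.denseSeq C(X, ℝ) k y ∂(ν x : Measure X)
        - ∫ y, TopologicalSpace.denseSeq C(X, ℝ) k y ∂μ| ≤ 1 / ((n : ℝ) + 1) :=
    eventually_countable_forall.2 fun k => eventually_countable_forall.2 fun n =>
      hres _ _ Nat.one_div_pos_of_nat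
  obtain ⟨x, hx⟩ := (dense_of_mem_residual hres').nonempty
  have hνμ : (ν x : Measure X) = μ := by
    refine ext_of_forall_integral_eq_of_dense (TopologicalSpace.denseRange_denseSeq C(X, ℝ)) ?_
    rintro _ ⟨k, rfl⟩
    have h0 := ge_of_tendsto' tendsto_one_div_add_atTop_nhds_zero_nat (hx k)
    exact sub_eq_zero.1 (abs_nonpos_iff.1 h0)
  have herg : Ergodic f^[p] μ := hνμ ▸ hν x
  refine hnue ⟨μ, ⟨hμ, herg.toMeasurePreserving.map_eq⟩, fun m hm => ?_⟩
  have := hm.1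
  refine herg.eq_of_absolutelyContinuous ⟨(hc.iterate p).measurable, hm.2⟩ ?_
  rw [← hue.average_map_iterate hc.measurable hp0 hm]
  refine Measure.AbsolutelyContinuous.smul_right ?_ (by simp)
  refine Measure.absolutelyContinuous_of_le ?_
  calc m = m.map f^[0] := by simp
    _ ≤ _ := Finset.single_le_sum (f := fun j => m.map f^[j]) (fun _ _ => Measure.zero_le _)
      (Finset.mem_range.2 hp.pos)
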